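/- Smallest sample size for reliable performance: let ε, β ∈ (0,1) and N ∈ ℕ with N ≥ ln(1/β)/ln(1/(1−ε)). Then the product measure μ^N of the set {(q^1,…,q^N) ∈ Ω^N : μ({q ∈ Ω : u(q) > û_N(q^1,…,q^N)}) > ε} is at most (1−ε)^N, which is at most β. -/

import Mathlib

open MeasureTheory

/-- If every ray `{u ≤ t}` with `t` in a lower set `A` has measure at most `c`, then so does the
preimage of `A`. -/
theorem measure_preimage_le_of_isLowerSet {Ω : Type*} [MeasurableSpace Ω] (μ : Measure Ω)
    (u : Ω → ℝ) {A : Set ℝ} (hA : IsLowerSet A) {c : ENNReal}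
    (h : ∀ t ∈ A, μ {ω | u ω ≤ t} ≤ c) : μ (u ⁻¹' A) ≤ c := by
  by_cases hmax : ∃ s, IsGreatest A s
  · obtain ⟨s, hsA, hs⟩ := hmax
    have hsub : u ⁻¹' A ⊆ {ω | u ω ≤ s} := fun ω hω => hs hω
    exact (measure_mono hsub).trans (h s hsA)
  · have hcover : u ⁻¹' A ⊆ ⋃ r : {r : ℚ // (r : ℝ) ∈ A}, {ω | u ω ≤ (r.1 : ℝ)} := by
      intro ω hω
      obtain ⟨t, htA, ht⟩ : ∃ t ∈ A, u ω < t := by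
        by_contra! hle
        exact hmax ⟨u ω, hω, hle⟩
      obtain ⟨r, hur, hrt⟩ := exists_rat_btwn ht
      exact Set.mem_iUnion.2 ⟨⟨r, hA hrt.le htA⟩, hur.le⟩
    have hmono : Monotone fun r : {r : ℚ // (r : ℝ) ∈ A} => {ω | u ω ≤ (r.1 : ℝ)} :=
      fun r s hrs ω (hω : u ω ≤ _) => hω.trans (Rat.cast_le.2 hrs)
    refine (measure_mono hcover).trans ?_
    rw [hmono.directed_le.measure_iUnion]
    exact iSup_le fun r => h _ r.2

/-- The event that the level `u ω` is exceeded with probability more than `ε` has probability at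
most `1 - ε`. -/
theorem measure_exceedance_gt_le {Ω : Type*} [MeasurableSpace Ω] (μ : Measure Ω)
    [IsProbabilityMeasure μ] {u : Ω → ℝ} (hu : Measurable u) (ε : ENNReal) :
    μ (u ⁻¹' {t | ε < μ {ω | t < u ω}}) ≤ 1 - ε := by
  have hlower : IsLowerSet {t | ε < μ {ω | t < u ω}} := fun s t hts (hs : ε < _) =>
    lt_of_lt_of_le hs (measure_mono fun ω (hω : s < u ω) => lt_of_le_of_lt hts hω)
  refine measure_preimage_le_of_isLowerSet μ u hlower fun t ht => ?_
  have hcompl : {ω | u ω ≤ t} = {ω | t < u ω}ᶜ := by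
    ext ω
    simp
  rw [hcompl, prob_compl_eq_one_sub (measurableSet_lt measurable_const hu)]
  exact tsub_le_tsub_left (le_of_lt ht) 1

/-- A sample size of at least `log (1 / β) / log (1 / (1 - ε))` makes `(1 - ε) ^ N` at most
`β`. -/
theorem one_sub_pow_le_of_log_div_log_le {ε β : ℝ} (hε : ε ∈ Set.Ioo (0 : ℝ) 1) (hβ : 0 < β)
    {N : ℕ} (hN : Real.log (1 / β) / Real.log (1 / (1 - ε)) ≤ N) : (1 - ε) ^ N ≤ β := by
  have hpos : 0 < 1 - ε := sub_pos.2 hε.2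
  have hlog : 0 < Real.log (1 / (1 - ε)) :=
    Real.log_pos ((one_lt_div hpos).2 (by linarith [hε.1]))
  rw [div_le_iff₀ hlog] at hN
  simp only [one_div, Real.log_inv] at hN
  rw [← Real.log_le_log_iff (pow_pos hpos N) hβ, Real.log_pow]
  linarith

/-- Smallest sample size for reliable performance: if
`N ≥ ln(1/β)/ln(1/(1−ε))`, then the probability (under `N` i.i.d. samples)
that the violation probability `μ{q : u(q) > û_N}` exceeds `ε` is at most
`(1−ε)^N`, which is at most `β`.  Here `û_N(q¹,…,q^N) = max_i u(qⁱ)`. -/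
theorem smallest_sample_size_reliable_performance
    {Ω : Type*} [MeasurableSpace Ω] (μ : Measure Ω) [IsProbabilityMeasure μ]
    (u : Ω → ℝ) (hu : Measurable u)
    (ε β : ℝ) (hε : ε ∈ Set.Ioo (0 : ℝ) 1) (hβ : β ∈ Set.Ioo (0 : ℝ) 1)
    (N : ℕ) (hN : Real.log (1 / β) / Real.log (1 / (1 - ε)) ≤ (N : ℝ)) :
    (Measure.pi fun _ : Fin N => μ)
        {q : Fin N → Ω |
          ENNReal.ofReal ε < μ {ω : Ω | (⨆ i : Fin N, u (q i)) < u ω}} ≤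
      ENNReal.ofReal ((1 - ε) ^ N) ∧
    (1 - ε) ^ N ≤ β := by
  refine ⟨?_, one_sub_pow_le_of_log_div_log_le hε hβ.1 hN⟩
  set A : Set ℝ := {t | ENNReal.ofReal ε < μ {ω | t < u ω}}
  have hsub : {q : Fin N → Ω | ENNReal.ofReal ε < μ {ω : Ω | (⨆ i : Fin N, u (q i)) < u ω}} ⊆
      Set.univ.pi fun _ : Fin N => u ⁻¹' A := fun q hq i _ =>
    lt_of_lt_of_le hq (measure_mono fun ω hω =>
      lt_of_le_of_lt (le_ciSup (f := fun j => u (q j)) (Set.finite_range _).bddAbove i) hω)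
  calc (Measure.pi fun _ : Fin N => μ) _
      ≤ (Measure.pi fun _ : Fin N => μ) (Set.univ.pi fun _ : Fin N => u ⁻¹' A) :=
        measure_mono hsub
    _ = μ (u ⁻¹' A) ^ N := by simp [Measure.pi_pi]
    _ ≤ (1 - ENNReal.ofReal ε) ^ N := by
        gcongr
        exact measure_exceedance_gt_le μ hu _
    _ = ENNReal.ofReal ((1 - ε) ^ N) := by
        rw [ENNReal.ofReal_pow (sub_nonneg.2 hε.2.le), ENNReal.ofReal_sub _ hε.1.le,
          ENNReal.ofReal_one]
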